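/- arXiv:1509.03817 — 4 statements merged into one kernel-verified Lean document; each statement's English description precedes it below -/
import Mathlib

section
/- Let E be a nonempty finite set, α, β : E → ℝ, and λₖ < Λ real numbers. Define α* := minₑ α(e), β* := min{β(e) : e ∈ E, α(e) = α*}, and λₖ₊₁ := min(Λ, min{λₖ + (α(e) − α*)/(β* − β(e)) : e ∈ E, β(e) < β*}), where the inner minimum is taken to be Λ if no e satisfies β(e) < β*. Then for every λ ∈ [λₖ, λₖ₊₁], the pointwise minimum minₑ (α(e) + β(e)·(λ − λₖ)) equals α* + β*·(λ − λₖ). -/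
/-- In the QDP procedure, with `α* = min α`, `β* = min{β(e) : α(e) = α*}` and
`λₖ₊₁ = min(Λ, min{λₖ + (α(e) - α*)/(β* - β(e)) : β(e) < β*})` (the inner
minimum being `Λ` if no arc satisfies `β(e) < β*`), the pointwise minimum of
the affine residual capacities `α(e) + β(e)·(λ - λₖ)` equals
`α* + β*·(λ - λₖ)` for every `λ ∈ [λₖ, λₖ₊₁]`. -/
theorem path_residual_capacity_affine_on_subinterval
    {E : Type*} [Fintype E] [Nonempty E]
    (α β : E → ℝ) (lk Lam : ℝ) (hkLam : lk < Lam)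
    (αs βs lk1 : ℝ)
    (hαs : IsLeast (Set.range α) αs)
    (hβs : IsLeast (β '' {e | α e = αs}) βs)
    (hlk1 : IsLeast
      (insert Lam {x | ∃ e, β e < βs ∧ x = lk + (α e - αs) / (βs - β e)}) lk1) :
    ∀ lam ∈ Set.Icc lk lk1,
      IsLeast (Set.range fun e => α e + β e * (lam - lk))
        (αs + βs * (lam - lk)) := by
  rintro lam ⟨h1, h2⟩
  obtain ⟨e0, he0, hb0⟩ := hβs.1
  have he0' : α e0 = αs := he0
  refine ⟨⟨e0, ?_⟩, ?_⟩
  · simp only [he0', hb0]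
  · rintro _ ⟨e, rfl⟩
    have ha : αs ≤ α e := hαs.2 ⟨e, rfl⟩
    show αs + βs * (lam - lk) ≤ α e + β e * (lam - lk)
    rcases lt_or_ge (β e) βs with h | h
    · have h3 : lk1 ≤ lk + (α e - αs) / (βs - β e) :=
        hlk1.2 (Set.mem_insert_of_mem _ ⟨e, h, rfl⟩)
      have h4 : lam - lk ≤ (α e - αs) / (βs - β e) := by linarith
      rw [le_div_iff₀ (by linarith)] at h4
      linarith
    · have := mul_le_mul_of_nonneg_right h (sub_nonneg.2 h1)
      linarith
end

section
/- Let V be a finite set, s, t ∈ V with s ≠ t, and f : V × V → ℝ with zero excess at every node other than s and t. Let v₀, v₁, …, v_q be a list of pairwise distinct nodes of V with v₀ = s and v_q = t, and let δ ∈ ℝ. Define f′ : V × V → ℝ from f by modifying, for each step 0 ≤ p < q, exactly one value: either f′(v_p, v_{p+1}) = f(v_p, v_{p+1}) − δ (the step uses a forward arc) or f′(v_{p+1}, v_p) = f(v_{p+1}, v_p) + δ (the step uses a reverse arc), all other values of f′ being equal to those of f. Then f′ has zero excess at every node other than s and t, and the value of f′ equals the value of f minus δ. -/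
/-- Decreasing a flow by `δ` along a path of pairwise distinct nodes
`v 0 = s, …, v q = t`, where each step either decreases the flow on the
forward arc `(vₚ, vₚ₊₁)` by `δ` or increases the flow on the reverse arc
`(vₚ₊₁, vₚ)` by `δ` (all other values unchanged), preserves zero excess at
every node other than `s` and `t` and decreases the flow value by `δ`. -/
theorem flow_decrease_along_path
    {V : Type*} [Fintype V] [DecidableEq V] (s t : V) (hst : s ≠ t)
    (f : V → V → ℝ)
    (hcons : ∀ i, i ≠ s → i ≠ t → (∑ j, f i j) - (∑ j, f j i) = 0)
    (q : ℕ) (v : Fin (q + 1) → V) (hinj : Function.Injective v)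
    (hv0 : v 0 = s) (hvq : v (Fin.last q) = t)
    (δ : ℝ) (d : Fin q → Bool) (f' : V → V → ℝ)
    (hf' : ∀ i j, f' i j = f i j +
      ∑ p : Fin q,
        ((if d p = true ∧ (i, j) = (v p.castSucc, v p.succ) then -δ else 0) +
         (if d p = false ∧ (i, j) = (v p.succ, v p.castSucc) then δ else 0))) :
    (∀ i, i ≠ s → i ≠ t → (∑ j, f' i j) - (∑ j, f' j i) = 0) ∧
      (∑ j, f' s j) - (∑ j, f' j s) = ((∑ j, f s j) - (∑ j, f j s)) - δ := by
  have step : ∀ (i a b : V) (c : Bool),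
      (∑ j, ((if c = true ∧ (i, j) = (a, b) then -δ else 0) +
         (if c = false ∧ (i, j) = (b, a) then δ else 0))) -
      (∑ j, ((if c = true ∧ (j, i) = (a, b) then -δ else 0) +
         (if c = false ∧ (j, i) = (b, a) then δ else 0))) =
      (if i = b then δ else 0) - (if i = a then δ else 0) := by
    intro i a b c
    cases c <;> by_cases h1 : i = a <;> by_cases h2 : i = b <;>
      simp [h1, h2, Prod.ext_iff] <;> simp_all
  have key : ∀ i, (∑ j, f' i j) - (∑ j, f' j i) =
      ((∑ j, f i j) - (∑ j, f j i)) +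
        ((if i = t then δ else 0) - (if i = s then δ else 0)) := by
    intro i
    have tel : ∑ p : Fin q, ((if i = v p.succ then δ else 0) -
        (if i = v p.castSucc then δ else 0)) =
        (if i = t then δ else 0) - (if i = s then δ else 0) := by
      have h1 := Fin.sum_univ_castSucc (fun p : Fin (q+1) => if i = v p then δ else 0)
      have h2 := Fin.sum_univ_succ (fun p : Fin (q+1) => if i = v p then δ else 0)
      rw [hvq] at h1
      rw [hv0] at h2
      rw [Finset.sum_sub_distrib]
      linarith
    rw [← tel, ← Finset.sum_congr rfl (fun p _ => step i (v p.castSucc) (v p.succ) (d p)),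
      Finset.sum_sub_distrib]
    simp only [hf']
    rw [Finset.sum_add_distrib, Finset.sum_add_distrib,
      Finset.sum_comm (s := (Finset.univ : Finset V)),
      Finset.sum_comm (s := (Finset.univ : Finset V))]
    ring
  refine ⟨fun i hs ht => ?_, ?_⟩
  · rw [key, hcons i hs ht]; simp [hs, ht]
  · rw [key]; simp [hst]; ring
end

section
/- Let V be a finite set, A ⊆ V × V a set of arcs, s, t ∈ V with s ≠ t, and ℓ, u : V × V → ℝ with ℓ(a) ≤ u(a) for every a ∈ A. Call f : V × V → ℝ feasible if f(i,j) = 0 for (i,j) ∉ A, ℓ(i,j) ≤ f(i,j) ≤ u(i,j) for (i,j) ∈ A, and f has zero excess at every node other than s and t. Given a feasible flow f, define the residual relation R on V by: R i j holds iff ((i,j) ∈ A and f(i,j) > ℓ(i,j)) or ((j,i) ∈ A and f(j,i) < u(j,i)). Then f has minimum value among all feasible flows (i.e., the value of f is ≤ the value of g for every feasible g) if and only if t is not reachable from s via the relation R. -/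
/-- Flow-decreasing path criterion for minimum flow: a feasible flow `f`
(vanishing off the arc set `A`, with `ℓ ≤ f ≤ u` on `A` and zero excess at
every node other than `s` and `t`) has minimum value among all feasible flows
iff the sink `t` is not reachable from the source `s` in the residual network,
whose arcs `(i,j)` are those with `(i,j) ∈ A ∧ f(i,j) > ℓ(i,j)` (forward) or
`(j,i) ∈ A ∧ f(j,i) < u(j,i)` (reverse). -/
theorem min_flow_iff_no_residual_path
    {V : Type*} [Fintype V] (A : Set (V × V)) (s t : V) (hst : s ≠ t)
    (ℓ u : V × V → ℝ) (hlu : ∀ a ∈ A, ℓ a ≤ u a)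
    (Feas : (V → V → ℝ) → Prop)
    (hFeas : ∀ g, Feas g ↔
      ((∀ i j, (i, j) ∉ A → g i j = 0) ∧
       (∀ i j, (i, j) ∈ A → ℓ (i, j) ≤ g i j ∧ g i j ≤ u (i, j)) ∧
       (∀ i, i ≠ s → i ≠ t → (∑ j, g i j) - (∑ j, g j i) = 0)))
    (f : V → V → ℝ) (hf : Feas f)
    (R : V → V → Prop)
    (hR : ∀ i j, R i j ↔
      (((i, j) ∈ A ∧ ℓ (i, j) < f i j) ∨ ((j, i) ∈ A ∧ f j i < u (j, i)))) :
    (∀ g, Feas g →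
        (∑ j, f s j) - (∑ j, f j s) ≤ (∑ j, g s j) - (∑ j, g j s)) ↔
      ¬ Relation.ReflTransGen R s t := by
  classical
  obtain ⟨f0, f1, f2⟩ := (hFeas f).1 hf
  constructor
  · intro hmin hreach
    have key : ∀ x, Relation.ReflTransGen R s x → ∃ d : V → V → ℝ,
        (∀ i j, d i j < 0 → (i, j) ∈ A ∧ ℓ (i, j) < f i j) ∧
        (∀ i j, 0 < d i j → (i, j) ∈ A ∧ f i j < u (i, j)) ∧
        (∀ i, (∑ j, d i j) - (∑ j, d j i) =
          (if i = x then 1 else 0) - (if i = s then 1 else 0)) := by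
      intro x hx
      induction hx with
      | refl => exact ⟨fun _ _ => 0, by simp, by simp, by simp⟩
      | @tail x y _ hxy ih =>
        obtain ⟨d, d1, d2, d3⟩ := ih
        rcases (hR x y).1 hxy with h | h
        · refine ⟨fun i j => d i j - (if i = x then 1 else 0) * (if j = y then 1 else 0),
            ?_, ?_, ?_⟩
          · intro i j hij
            by_cases hd : d i j < 0
            · exact d1 i j hd
            · by_cases hi : i = x <;> by_cases hj : j = y <;> simp [hi, hj] at hij hd ⊢ <;>
                first | exact h | linarith
          · intro i j hij
            apply d2 i j
            by_cases hi : i = x <;> by_cases hj : j = y <;> simp [hi, hj] at hij ⊢ <;> linarith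
          · intro i
            have := d3 i
            simp only [Finset.sum_sub_distrib, ← Finset.mul_sum, ← Finset.sum_mul,
              Finset.sum_ite_eq', Finset.mem_univ, if_true]
            linarith
        · refine ⟨fun i j => d i j + (if i = y then 1 else 0) * (if j = x then 1 else 0),
            ?_, ?_, ?_⟩
          · intro i j hij
            apply d1 i j
            by_cases hi : i = y <;> by_cases hj : j = x <;> simp [hi, hj] at hij ⊢ <;> linarith
          · intro i j hij
            by_cases hd : 0 < d i j
            · exact d2 i j hd
            · by_cases hi : i = y <;> by_cases hj : j = x <;> simp [hi, hj] at hij hd ⊢ <;>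
                first | exact h | linarith
          · intro i
            have := d3 i
            simp only [Finset.sum_add_distrib, ← Finset.mul_sum, ← Finset.sum_mul,
              Finset.sum_ite_eq', Finset.mem_univ, if_true]
            linarith
    obtain ⟨d, d1, d2, d3⟩ := key t hreach
    have hev : ∀ᶠ e : ℝ in nhdsWithin 0 (Set.Ioi 0), ∀ i j, (i, j) ∈ A →
        ℓ (i, j) ≤ f i j + e * d i j ∧ f i j + e * d i j ≤ u (i, j) := by
      rw [Filter.eventually_all]; intro i
      rw [Filter.eventually_all]; intro j
      by_cases hA : (i, j) ∈ A
      swap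
      · simp [hA]
      have hc : Filter.Tendsto (fun e : ℝ => f i j + e * d i j)
          (nhdsWithin 0 (Set.Ioi 0)) (nhds (f i j)) := by
        have : Continuous (fun e : ℝ => f i j + e * d i j) := by fun_prop
        have h2 := this.tendsto 0
        simp only [zero_mul, add_zero] at h2
        exact h2.mono_left nhdsWithin_le_nhds
      have hpos : ∀ᶠ e : ℝ in nhdsWithin 0 (Set.Ioi 0), 0 < e := self_mem_nhdsWithin
      have hb := f1 i j hA
      rcases lt_trichotomy (d i j) 0 with hd | hd | hd
      · filter_upwards [hpos, hc.eventually (lt_mem_nhds (d1 i j hd).2)] with e he h1 _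
        exact ⟨h1.le, by nlinarith⟩
      · simp [hd, hb]
      · filter_upwards [hpos, hc.eventually (gt_mem_nhds (d2 i j hd).2)] with e he h1 _
        exact ⟨by nlinarith, h1.le⟩
    have hpos : ∀ᶠ e : ℝ in nhdsWithin 0 (Set.Ioi 0), 0 < e := self_mem_nhdsWithin
    obtain ⟨e, he, hpe⟩ := (hev.and hpos).exists
    have hex : ∀ i, (∑ j, (f i j + e * d i j)) - (∑ j, (f j i + e * d j i)) =
        ((∑ j, f i j) - (∑ j, f j i)) +
          e * ((if i = t then 1 else 0) - (if i = s then 1 else 0)) := by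
      intro i
      rw [← d3 i]
      simp only [Finset.sum_add_distrib, ← Finset.mul_sum]
      ring
    have hg := hmin (fun i j => f i j + e * d i j) ((hFeas _).2 ⟨?_, he, ?_⟩)
    · simp only [hex, hst, if_true, if_false] at hg
      linarith
    · intro i j hA
      have a1 : ¬ d i j < 0 := fun h => hA (d1 i j h).1
      have a2 : ¬ 0 < d i j := fun h => hA (d2 i j h).1
      have a3 : d i j = 0 := by linarith
      simp [f0 i j hA, a3]
    · intro i his hit
      simp only [hex, his, hit, if_false]
      rw [f2 i his hit]; simp
  · intro hnr g hg
    obtain ⟨g0, g1, g2⟩ := (hFeas g).1 hg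
    let c : V → ℝ := fun i => if Relation.ReflTransGen R s i then 1 else 0
    have hsum : ∀ k : V → V → ℝ,
        (∀ i, i ≠ s → i ≠ t → (∑ j, k i j) - (∑ j, k j i) = 0) →
        (∑ j, k s j) - (∑ j, k j s) = ∑ i, ∑ j, (c i - c j) * k i j := by
      intro k hk
      have e1 : ∑ i, c i * ((∑ j, k i j) - (∑ j, k j i)) =
          (∑ j, k s j) - (∑ j, k j s) := by
        rw [Finset.sum_eq_single s]
        · simp [c, Relation.ReflTransGen.refl]
        · intro i _ his
          by_cases hit : i = t
          · subst hit; simp [c, hnr]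
          · rw [hk i his hit, mul_zero]
        · simp
      rw [← e1]
      simp only [mul_sub, sub_mul, Finset.sum_sub_distrib, Finset.mul_sum]
      congr 1
      exact Finset.sum_comm
    rw [hsum f f2, hsum g g2]
    refine Finset.sum_le_sum fun i _ => Finset.sum_le_sum fun j _ => ?_
    by_cases hA : (i, j) ∈ A
    swap
    · rw [f0 i j hA, g0 i j hA]
    have hb := g1 i j hA
    by_cases hi : Relation.ReflTransGen R s i <;> by_cases hj : Relation.ReflTransGen R s j <;>
      simp only [c, hi, hj, if_true, if_false]
    · simp
    · have : ¬ ℓ (i, j) < f i j := fun h => hj (hi.tail ((hR i j).2 (Or.inl ⟨hA, h⟩)))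
      linarith
    · have : ¬ f i j < u (i, j) := fun h => hi (hj.tail ((hR j i).2 (Or.inr ⟨hA, h⟩)))
      linarith
    · simp
end

section
/- Let V be a finite set, A ⊆ V × V, s, t ∈ V with s ≠ t, Λ > 0, and let u, ℓ₀, 𝓛 : V × V → ℝ. For λ ∈ [0, Λ], call f : V × V → ℝ feasible for λ if f vanishes off A, satisfies ℓ₀(a) + λ·𝓛(a) ≤ f(a) ≤ u(a) for every a ∈ A, and has zero excess at every node other than s and t; assume a feasible flow exists for every λ ∈ [0, Λ]. Define v(λ) as the minimum value of a flow feasible for λ. Then v is piecewise linear on [0, Λ]: there exist K ≥ 1, breakpoints 0 = μ₀ < μ₁ < ⋯ < μ_K = Λ, and reals a₁, b₁, …, a_K, b_K such that v(λ) = a_k + b_k·λ for every λ ∈ [μ_{k−1}, μ_k] and every 1 ≤ k ≤ K. -/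
/-- A predicate cut out by finitely many linear inequalities. -/
def IsPolyP {E : Type*} [AddCommGroup E] [Module ℝ E] (S : E → Prop) : Prop :=
  ∃ F : Set ((E →ₗ[ℝ] ℝ) × ℝ), F.Finite ∧ ∀ x, S x ↔ ∀ p ∈ F, p.1 x ≤ p.2

section poly
variable {E : Type*} [AddCommGroup E] [Module ℝ E]

theorem IsPolyP.half (φ : E → ℝ) (h : IsLinearMap ℝ φ) (c : ℝ) : IsPolyP (fun x => φ x ≤ c) :=
  ⟨{(h.mk' φ, c)}, Set.finite_singleton _, fun x => by simp⟩

theorem IsPolyP.true : IsPolyP (fun _ : E => True) :=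
  ⟨∅, Set.finite_empty, fun x => by simp⟩

theorem IsPolyP.and {S T : E → Prop} (hS : IsPolyP S) (hT : IsPolyP T) :
    IsPolyP (fun x => S x ∧ T x) := by
  obtain ⟨F, hF, h1⟩ := hS
  obtain ⟨G, hG, h2⟩ := hT
  refine ⟨F ∪ G, hF.union hG, fun x => ?_⟩
  simp only [h1, h2, Set.mem_union, or_imp, forall_and]

theorem IsPolyP.eq (φ : E → ℝ) (h : IsLinearMap ℝ φ) (c : ℝ) : IsPolyP (fun x => φ x = c) := by
  have h1 := (IsPolyP.half φ h c).and (IsPolyP.half (fun x => - φ x)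
    ⟨fun x y => by rw [h.map_add]; ring, fun a x => by rw [h.map_smul]; simp⟩ (-c))
  convert h1 using 2 with x
  constructor
  · rintro h; simp [h]
  · rintro ⟨h, h'⟩; linarith

theorem IsPolyP.all {ι : Type*} [Finite ι] {S : ι → E → Prop} (hS : ∀ i, IsPolyP (S i)) :
    IsPolyP (fun x => ∀ i, S i x) := by
  choose F hF h using hS
  refine ⟨⋃ i, F i, Set.finite_iUnion hF, fun x => ?_⟩
  simp only [h, Set.mem_iUnion]
  exact ⟨fun h p ⟨i, hi⟩ => h i p hi, fun h i p hi => h p ⟨i, hi⟩⟩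

theorem IsPolyP.imp (P : Prop) {S : E → Prop} (hS : IsPolyP S) :
    IsPolyP (fun x => P → S x) := by
  by_cases hP : P
  · simpa [hP] using hS
  · simpa [hP] using IsPolyP.true

theorem exists_between_fin {l u : Set ℝ} (hl : l.Finite) (hu : u.Finite)
    (h : ∀ a ∈ l, ∀ b ∈ u, a ≤ b) : ∃ y, (∀ a ∈ l, a ≤ y) ∧ ∀ b ∈ u, y ≤ b := by
  rcases l.eq_empty_or_nonempty with rfl | hne
  · obtain ⟨y, hy⟩ := hu.bddBelow
    exact ⟨y, by simp, fun b hb => hy hb⟩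
  · obtain ⟨m, hm, hmax⟩ := hl.exists_maximal hne
    refine ⟨m, fun a ha => ?_, fun b hb => h m hm b hb⟩
    rcases le_total a m with h1 | h1
    · exact h1
    · exact hmax ha h1

theorem IsPolyP.elim {S : E → Prop} (hS : IsPolyP S) (w : E) :
    IsPolyP (fun x => ∃ y : ℝ, S (x + y • w)) := by
  obtain ⟨F, hF, h⟩ := hS
  refine ⟨{p ∈ F | p.1 w = 0} ∪
    Set.image2 (fun p q => ((-(q.1 w)) • p.1 + (p.1 w) • q.1, (-(q.1 w)) * p.2 + (p.1 w) * q.2))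
      {p ∈ F | 0 < p.1 w} {q ∈ F | q.1 w < 0}, (hF.sep _).union
        ((hF.sep _).image2 _ (hF.sep _)), fun x => ?_⟩
  simp only [h]
  constructor
  · rintro ⟨y, hy⟩ r (⟨hr, hr0⟩ | ⟨p, ⟨hp, hp0⟩, q, ⟨hq, hq0⟩, rfl⟩)
    · have := hy r hr
      simpa [hr0] using this
    · have h1 := hy p hp
      have h2 := hy q hq
      simp only [map_add, map_smul, smul_eq_mul, LinearMap.add_apply, LinearMap.smul_apply] at *
      nlinarith
  · intro H
    obtain ⟨y, hy1, hy2⟩ := exists_between_fin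
      (l := (fun q : (E →ₗ[ℝ] ℝ) × ℝ => (q.2 - q.1 x) / q.1 w) '' {q ∈ F | q.1 w < 0})
      (u := (fun q : (E →ₗ[ℝ] ℝ) × ℝ => (q.2 - q.1 x) / q.1 w) '' {q ∈ F | 0 < q.1 w})
      ((hF.sep _).image _) ((hF.sep _).image _) (by
        rintro _ ⟨q, hq, rfl⟩ _ ⟨p, hp, rfl⟩
        have := H _ (Or.inr ⟨p, hp, q, hq, rfl⟩)
        have hp0 := hp.2
        have hq0 := hq.2
        simp only [smul_eq_mul, LinearMap.add_apply, LinearMap.smul_apply] at this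
        simp only
        rw [div_le_iff_of_neg hq0, div_mul_eq_mul_div, div_le_iff₀ hp0]
        nlinarith)
    refine ⟨y, fun p hp => ?_⟩
    simp only [map_add, map_smul, smul_eq_mul]
    rcases lt_trichotomy (p.1 w) 0 with h0 | h0 | h0
    · have := hy1 _ ⟨p, ⟨hp, h0⟩, rfl⟩
      simp only at this
      rw [div_le_iff_of_neg h0] at this
      linarith
    · have := H p (Or.inl ⟨hp, h0⟩)
      simpa [h0] using this
    · have := hy2 _ ⟨p, ⟨hp, h0⟩, rfl⟩
      simp only at this
      rw [le_div_iff₀ h0] at this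
      linarith

theorem IsPolyP.proj {S : E → Prop} (hS : IsPolyP S) (W : Submodule ℝ E) (hW : W.FG) :
    IsPolyP (fun x => ∃ w ∈ W, S (x + w)) := by
  revert S
  refine Submodule.fg_induction (motive := fun W _ => ∀ {S : E → Prop}, IsPolyP S →
    IsPolyP (fun x => ∃ w ∈ W, S (x + w))) ?_ ?_ W hW
  · intro w S hS
    simpa [Submodule.mem_span_singleton] using hS.elim w
  · intro M N _ _ hM hN S hS
    have := hM (hN hS)
    convert this using 2 with x
    constructor
    · rintro ⟨w, hw, h⟩
      obtain ⟨a, ha, b, hb, rfl⟩ := Submodule.mem_sup.1 hw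
      exact ⟨a, ha, b, hb, by rwa [add_assoc]⟩
    · rintro ⟨a, ha, b, hb, h⟩
      exact ⟨a + b, Submodule.add_mem_sup ha hb, by rwa [← add_assoc]⟩

end poly

/-- The maximum of finitely many affine functions is piecewise affine. -/
theorem piecewise_of_max (Lam : ℝ) (hLam : 0 < Lam) (v : ℝ → ℝ) (H : Set (ℝ × ℝ)) (hH : H.Finite)
    (h1 : ∀ x ∈ Set.Icc (0 : ℝ) Lam, ∀ p ∈ H, p.1 + p.2 * x ≤ v x)
    (h2 : ∀ x ∈ Set.Icc (0 : ℝ) Lam, ∃ p ∈ H, v x = p.1 + p.2 * x) :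
    ∃ K : ℕ, 1 ≤ K ∧ ∃ μ a b : ℕ → ℝ,
      μ 0 = 0 ∧ μ K = Lam ∧ (∀ k < K, μ k < μ (k + 1)) ∧
      ∀ k, 1 ≤ k → k ≤ K →
        ∀ lam ∈ Set.Icc (μ (k - 1)) (μ k), v lam = a k + b k * lam := by
  classical
  -- affine on crossing free intervals
  have key : ∀ c d : ℝ, 0 ≤ c → c < d → d ≤ Lam →
      (∀ p ∈ H, ∀ q ∈ H, (q.1 - p.1) / (p.2 - q.2) ∉ Set.Ioo c d) →
      ∃ r : ℝ × ℝ, ∀ x ∈ Set.Icc c d, v x = r.1 + r.2 * x := by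
    intro c d hc hcd hd hno
    obtain ⟨r, hr, hrm⟩ := h2 ((c + d) / 2) ⟨by linarith, by linarith⟩
    refine ⟨r, fun x hx => ?_⟩
    have hx' : x ∈ Set.Icc (0 : ℝ) Lam := ⟨hc.trans hx.1, hx.2.trans hd⟩
    refine le_antisymm ?_ (h1 x hx' r hr)
    obtain ⟨q, hq, hqx⟩ := h2 x hx'
    rw [hqx]
    by_contra! hlt
    have hm : q.1 + q.2 * ((c + d) / 2) ≤ r.1 + r.2 * ((c + d) / 2) :=
      hrm ▸ h1 ((c + d) / 2) ⟨by linarith, by linarith⟩ q hq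
    apply hno r hr q hq
    obtain ⟨hx1, hx2⟩ := hx
    rcases lt_trichotomy (r.2 - q.2) 0 with h0 | h0 | h0
    · constructor
      · rw [lt_div_iff_of_neg h0]; nlinarith
      · rw [div_lt_iff_of_neg h0]; nlinarith
    · exfalso
      have : r.2 = q.2 := by linarith
      rw [this] at hlt hm
      linarith
    · constructor
      · rw [lt_div_iff₀ h0]; nlinarith
      · rw [div_lt_iff₀ h0]; nlinarith
  let C : Finset ℝ := ((hH.toFinset ×ˢ hH.toFinset).image
    (fun z => (z.2.1 - z.1.1) / (z.1.2 - z.2.2))).filter (fun x => x ∈ Set.Ioo 0 Lam)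
  let S : Finset ℝ := insert 0 (insert Lam C)
  have hSI : ∀ x ∈ S, 0 ≤ x ∧ x ≤ Lam := by
    intro x hx
    simp only [S, C, Finset.mem_insert, Finset.mem_filter, Set.mem_Ioo] at hx
    rcases hx with rfl | rfl | ⟨-, hx⟩
    · exact ⟨le_rfl, hLam.le⟩
    · exact ⟨hLam.le, le_rfl⟩
    · exact ⟨hx.1.le, hx.2.le⟩
  have h0S : (0 : ℝ) ∈ S := by simp [S]
  have hLS : Lam ∈ S := by simp [S]
  have hcard : 1 < S.card := Finset.one_lt_card.2 ⟨0, h0S, Lam, hLS, hLam.ne⟩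
  obtain ⟨K, hK⟩ : ∃ K, S.card = K + 1 := ⟨S.card - 1, by omega⟩
  let e := S.orderEmbOfFin hK
  have hsurj : ∀ x ∈ S, ∃ i, e i = x := by
    intro x hx
    have : x ∈ Set.range e := by rw [Finset.range_orderEmbOfFin]; exact hx
    exact this
  have hmem : ∀ i, e i ∈ S := fun i => Finset.orderEmbOfFin_mem S hK i
  have hstep : ∀ k, ∃ r : ℝ × ℝ, ∀ (h : k + 1 < K + 1), ∀ x ∈
      Set.Icc (e ⟨k, by omega⟩) (e ⟨k + 1, h⟩), v x = r.1 + r.2 * x := by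
    intro k
    by_cases h : k + 1 < K + 1
    · obtain ⟨r, hr⟩ := key (e ⟨k, by omega⟩) (e ⟨k + 1, h⟩) (hSI _ (hmem _)).1
        (e.strictMono (by simp [Fin.lt_def])) (hSI _ (hmem _)).2 (by
          intro p hp q hq hin
          obtain ⟨i, hi⟩ := hsurj ((q.1 - p.1) / (p.2 - q.2)) (by
            simp only [S, C, Finset.mem_insert, Finset.mem_filter, Finset.mem_image]
            right; right
            refine ⟨⟨(p, q), by simp [hp, hq], rfl⟩, ?_, ?_⟩
            · exact lt_of_le_of_lt (hSI _ (hmem _)).1 hin.1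
            · exact lt_of_lt_of_le hin.2 (hSI _ (hmem _)).2)
          rw [← hi] at hin
          have a1 := e.lt_iff_lt.1 hin.1
          have a2 := e.lt_iff_lt.1 hin.2
          simp only [Fin.lt_def] at a1 a2
          omega)
      exact ⟨r, fun _ => hr⟩
    · exact ⟨0, fun h' => absurd h' h⟩
  choose r hr using hstep
  refine ⟨K, by omega, fun k => if h : k < K + 1 then e ⟨k, h⟩ else 0,
    fun k => (r (k - 1)).1, fun k => (r (k - 1)).2, ?_, ?_, ?_, ?_⟩
  · simp only [Nat.succ_pos, dif_pos]
    obtain ⟨i, hi⟩ := hsurj 0 h0S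
    refine le_antisymm ?_ (hSI _ (hmem _)).1
    rw [← hi]
    exact e.monotone (by simp [Fin.le_def])
  · simp only [Nat.lt_succ_self, dif_pos]
    obtain ⟨i, hi⟩ := hsurj Lam hLS
    refine le_antisymm (hSI _ (hmem _)).2 ?_
    rw [← hi]
    exact e.monotone (by simp only [Fin.le_def]; omega)
  · intro k hk
    simp only [show k < K + 1 by omega, show k + 1 < K + 1 by omega, dif_pos]
    exact e.strictMono (by simp [Fin.lt_def])
  · intro k hk hkK x hx
    obtain ⟨m, rfl⟩ : ∃ m, k = m + 1 := ⟨k - 1, by omega⟩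
    simp only [Nat.add_sub_cancel, show m < K + 1 by omega, show m + 1 < K + 1 by omega,
      dif_pos] at hx ⊢
    exact hr m (by omega) x hx

/-- The minimum parametric flow value function `v(λ)`, where for each
`λ ∈ [0, Λ]` a feasible flow vanishes off the arc set `A`, satisfies the
parametric bounds `ℓ₀(a) + λ·𝓛(a) ≤ f(a) ≤ u(a)` on `A` and has zero excess
at every node other than `s` and `t`, is piecewise linear on `[0, Λ]`:
there are breakpoints `0 = μ₀ < μ₁ < ⋯ < μ_K = Λ` such that `v` is affine on
each subinterval `[μ_{k-1}, μ_k]`. -/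
theorem parametric_min_flow_value_piecewise_linear
    {V : Type*} [Fintype V] (A : Set (V × V)) (s t : V) (hst : s ≠ t)
    (Lam : ℝ) (hLam : 0 < Lam) (u ℓ₀ L : V × V → ℝ)
    (Feas : ℝ → (V → V → ℝ) → Prop)
    (hFeas : ∀ lam g, Feas lam g ↔
      ((∀ i j, (i, j) ∉ A → g i j = 0) ∧
       (∀ i j, (i, j) ∈ A →
          ℓ₀ (i, j) + lam * L (i, j) ≤ g i j ∧ g i j ≤ u (i, j)) ∧
       (∀ i, i ≠ s → i ≠ t → (∑ j, g i j) - (∑ j, g j i) = 0)))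
    (hex : ∀ lam ∈ Set.Icc (0 : ℝ) Lam, ∃ g, Feas lam g)
    (v : ℝ → ℝ)
    (hv : ∀ lam ∈ Set.Icc (0 : ℝ) Lam,
      IsLeast {x | ∃ g, Feas lam g ∧ x = (∑ j, g s j) - (∑ j, g j s)} (v lam)) :
    ∃ K : ℕ, 1 ≤ K ∧ ∃ μ a b : ℕ → ℝ,
      μ 0 = 0 ∧ μ K = Lam ∧ (∀ k < K, μ k < μ (k + 1)) ∧
      ∀ k, 1 ≤ k → k ≤ K →
        ∀ lam ∈ Set.Icc (μ (k - 1)) (μ k), v lam = a k + b k * lam := by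
  classical
  have hP : IsPolyP (fun z : (ℝ × ℝ) × (V → V → ℝ) =>
      ((∀ i j, (i, j) ∉ A → z.2 i j = 0) ∧
       (∀ i j, (i, j) ∈ A →
          -z.2 i j + z.1.1 * L (i, j) ≤ - ℓ₀ (i, j) ∧ z.2 i j ≤ u (i, j)) ∧
       (∀ i, i ≠ s → i ≠ t → (∑ j, z.2 i j) - (∑ j, z.2 j i) = 0)) ∧
       z.1.2 - ((∑ j, z.2 s j) - (∑ j, z.2 j s)) = 0) := by
    refine .and (.and ?_ (.and ?_ ?_)) ?_
    · refine .all fun i => .all fun j => .imp _ (.eq _ ⟨fun x y => ?_, fun c x => ?_⟩ _)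
      · simp
      · simp
    · refine .all fun i => .all fun j => .imp _ (.and
        (.half _ ⟨fun x y => ?_, fun c x => ?_⟩ _) (.half _ ⟨fun x y => ?_, fun c x => ?_⟩ _))
      · simp; ring
      · simp; ring
      · simp
      · simp
    · refine .all fun i => .imp _ (.imp _ (.eq _ ⟨fun x y => ?_, fun c x => ?_⟩ _))
      · simp [Finset.sum_add_distrib]; ring
      · simp [← Finset.mul_sum]; ring
    · refine .eq _ ⟨fun x y => ?_, fun c x => ?_⟩ _
      · simp [Finset.sum_add_distrib]; ring
      · simp [← Finset.mul_sum]; ring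
  obtain ⟨F, hF, hFP⟩ := hP.proj (LinearMap.range (LinearMap.inr ℝ (ℝ × ℝ) (V → V → ℝ)))
    (IsNoetherian.noetherian _)
  have hval : ∀ lam x, (∃ g, Feas lam g ∧ x = (∑ j, g s j) - (∑ j, g j s)) ↔
      ∀ p ∈ F, lam * p.1 ((1, 0), 0) + x * p.1 ((0, 1), 0) ≤ p.2 := by
    intro lam x
    have e : ∀ p : ((ℝ × ℝ) × (V → V → ℝ)) →ₗ[ℝ] ℝ,
        lam * p ((1, 0), 0) + x * p ((0, 1), 0) = p ((lam, x), 0) := by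
      intro p
      rw [← smul_eq_mul, ← smul_eq_mul, ← map_smul, ← map_smul, ← map_add]
      simp
    simp only [e]
    rw [← hFP]
    constructor
    · rintro ⟨g, hg, hx⟩
      rw [hFeas] at hg
      refine ⟨((0, 0), g), ⟨g, rfl⟩, ?_⟩
      simp only [Prod.mk_add_mk, add_zero, zero_add]
      refine ⟨⟨hg.1, fun i j hij => ⟨?_, (hg.2.1 i j hij).2⟩, hg.2.2⟩, by linarith⟩
      linarith [(hg.2.1 i j hij).1]
    · rintro ⟨_, ⟨g, rfl⟩, hg⟩
      simp only [LinearMap.inr_apply, Prod.mk_add_mk, add_zero, zero_add, Prod.fst_zero, Prod.snd_zero,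
        Prod.fst_add, Prod.snd_add] at hg
      refine ⟨g, (hFeas _ _).2 ⟨hg.1.1, fun i j hij => ⟨?_, (hg.1.2.1 i j hij).2⟩, hg.1.2.2⟩,
        by linarith [hg.2]⟩
      linarith [(hg.1.2.1 i j hij).1]
  refine piecewise_of_max Lam hLam v ((fun p => (p.2 / p.1 ((0, 1), 0),
    -p.1 ((1, 0), 0) / p.1 ((0, 1), 0))) '' {p ∈ F | p.1 ((0, 1), 0) < 0})
    ((hF.sep _).image _) ?_ ?_
  · rintro lam hlam _ ⟨p, ⟨hp, hp0⟩, rfl⟩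
    have := (hval lam (v lam)).1 (hv lam hlam).1 p hp
    simp only
    rw [div_mul_eq_mul_div, ← add_div, div_le_iff_of_neg hp0]
    linarith
  · intro lam hlam
    by_contra! hne
    have hle := (hval lam (v lam)).1 (hv lam hlam).1
    -- a finite set of lower bounds, all strictly below
    obtain ⟨y, hy1, hy2⟩ : ∃ y, (∀ p ∈ F, p.1 ((0, 1), 0) < 0 →
        (p.2 - lam * p.1 ((1, 0), 0)) / p.1 ((0, 1), 0) < y) ∧ y < v lam := by
      obtain ⟨y, hy1, hy2⟩ := Order.exists_between_finsets
        (((hF.sep (fun p => p.1 ((0, 1), 0) < 0)).toFinset).image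
          (fun p => (p.2 - lam * p.1 ((1, 0), 0)) / p.1 ((0, 1), 0))) {v lam} (by
          intro a ha b hb
          simp only [Finset.mem_image, Set.Finite.mem_toFinset, Finset.mem_singleton] at ha hb
          obtain ⟨p, ⟨hp, hp0⟩, rfl⟩ := ha
          subst hb
          refine lt_of_le_of_ne ?_ ?_
          · rw [div_le_iff_of_neg hp0]
            linarith [hle p hp]
          · intro h
            refine hne _ ⟨p, ⟨hp, hp0⟩, rfl⟩ ?_
            rw [← h]
            simp only
            ring)
      refine ⟨y, fun p hp hp0 => hy1 _ ?_, hy2 _ (by simp)⟩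
      exact Finset.mem_image.2 ⟨p, by simp [hp, hp0], rfl⟩
    have : v lam ≤ y := (hv lam hlam).2 ((hval lam y).2 (by
      intro p hp
      rcases lt_or_ge (p.1 ((0, 1), 0)) 0 with h0 | h0
      · have := hy1 p hp h0
        rw [div_lt_iff_of_neg h0] at this
        linarith
      · have := hle p hp
        nlinarith))
    linarith
end
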